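/- arXiv:2309.05008 — 4 statements merged into one kernel-verified Lean document; each statement's English description precedes it below -/
import Mathlib

section
/- Let V be a finite-dimensional real vector space and Q a symmetric bilinear form on V with exactly one positive eigenvalue. Assume x, y ∈ V satisfy Q(x,x) ≥ 0, Q(y,y) ≥ 0 and Q(x,y)² = Q(x,x)·Q(y,y). Then the linear forms Q(x,·) and Q(y,·) on V are linearly dependent (proportional). -/
/-- If a symmetric bilinear form has at most one positive eigenvalue, it is nonpositive on the
orthogonal complement of a positive vector. -/
theorem apply_self_nonpos_of_orthogonal_pos {V : Type*} [AddCommGroup V] [Module ℝ V]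
    (Q : V →ₗ[ℝ] V →ₗ[ℝ] ℝ) (hQsymm : ∀ x y : V, Q x y = Q y x)
    (hQone : ∀ W : Submodule ℝ V, (∀ x ∈ W, x ≠ 0 → 0 < Q x x) → Module.finrank ℝ W ≤ 1)
    {u v : V} (hu : 0 < Q u u) (huv : Q u v = 0) : Q v v ≤ 0 := by
  by_contra! hv
  have hvu : Q v u = 0 := by rw [hQsymm, huv]
  have expand (a b : ℝ) :
      Q (a • u + b • v) (a • u + b • v) = a ^ 2 * Q u u + b ^ 2 * Q v v := by
    simp only [map_add, map_smul, LinearMap.add_apply, LinearMap.smul_apply, smul_eq_mul,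
      huv, hvu]
    ring
  have hli : LinearIndependent ℝ ![u, v] := by
    rw [LinearIndependent.pair_iff]
    intro a b h
    have h0 := expand a b
    rw [h, map_zero] at h0
    have ha := mul_nonneg (sq_nonneg a) hu.le
    have hb := mul_nonneg (sq_nonneg b) hv.le
    have ha0 : a ^ 2 * Q u u = 0 := by linarith
    have hb0 : b ^ 2 * Q v v = 0 := by linarith
    simpa [hu.ne', hv.ne'] using And.intro ha0 hb0
  have hcard := finrank_span_eq_card hli
  have hle := hQone (Submodule.span ℝ (Set.range ![u, v])) fun x hx hx0 => by
    rw [Matrix.range_cons_cons_empty, Submodule.mem_span_pair] at hx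
    obtain ⟨a, b, rfl⟩ := hx
    rw [expand]
    rcases eq_or_ne a 0 with rfl | ha
    · have hb : b ≠ 0 := by
        rintro rfl
        simp at hx0
      positivity
    · positivity
  rw [Fintype.card_fin] at hcard
  omega

/-- If a symmetric bilinear form has at most one positive eigenvalue, an isotropic vector
orthogonal to a positive vector lies in the radical. -/
theorem apply_eq_zero_of_isotropic_of_orthogonal_pos {V : Type*} [AddCommGroup V] [Module ℝ V]
    (Q : V →ₗ[ℝ] V →ₗ[ℝ] ℝ) (hQsymm : ∀ x y : V, Q x y = Q y x)
    (hQone : ∀ W : Submodule ℝ V, (∀ x ∈ W, x ≠ 0 → 0 < Q x x) → Module.finrank ℝ W ≤ 1)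
    {u w : V} (hu : 0 < Q u u) (huw : Q u w = 0) (hw : Q w w = 0) (z : V) : Q w z = 0 := by
  obtain ⟨z', hz'⟩ : ∃ z', z' = z - (Q u z / Q u u) • u := ⟨_, rfl⟩
  have huz' : Q u z' = 0 := by
    rw [hz', map_sub, map_smul, smul_eq_mul, div_mul_cancel₀ _ hu.ne', sub_self]
  have hwz' : Q w z' = Q w z := by
    rw [hz', map_sub, map_smul, hQsymm w u, huw, smul_zero, sub_zero]
  have key (t : ℝ) : 2 * t * Q w z + Q z' z' ≤ 0 := by
    have h := apply_self_nonpos_of_orthogonal_pos Q hQsymm hQone (v := t • w + z') hu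
      (by simp [huw, huz'])
    simp only [map_add, map_smul, LinearMap.add_apply, LinearMap.smul_apply, smul_eq_mul, hw,
      hQsymm z' w, hwz'] at h
    linarith
  by_contra hne
  have h := key ((1 - Q z' z') / (2 * Q w z))
  have : 2 * ((1 - Q z' z') / (2 * Q w z)) * Q w z = 1 - Q z' z' := by field_simp
  linarith

/-- Let `V` be a finite-dimensional real vector space and `Q` a symmetric
bilinear form on `V` with exactly one positive eigenvalue (at most one positive eigenvalue,
and `Q` takes a positive value on some vector). If `x, y ∈ V` satisfy `Q x x ≥ 0`, `Q y y ≥ 0`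
and `Q x y ^ 2 = Q x x * Q y y`, then the linear forms `Q x` and `Q y` are linearly dependent
(proportional). -/
theorem lorentzian_proportionality
    {V : Type*} [AddCommGroup V] [Module ℝ V] [FiniteDimensional ℝ V]
    (Q : V →ₗ[ℝ] V →ₗ[ℝ] ℝ)
    (hQsymm : ∀ x y : V, Q x y = Q y x)
    (hQone : ∀ W : Submodule ℝ V, (∀ x ∈ W, x ≠ 0 → 0 < Q x x) → Module.finrank ℝ W ≤ 1)
    (hQpos : ∃ v : V, 0 < Q v v)
    (x y : V) (hx : 0 ≤ Q x x) (hy : 0 ≤ Q y y)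
    (hxy : Q x y ^ 2 = Q x x * Q y y) :
    ∃ a b : ℝ, (a ≠ 0 ∨ b ≠ 0) ∧ ∀ z : V, a * Q x z + b * Q y z = 0 := by
  have radical {u : V} (hu : 0 < Q u u) (a b : ℝ) (huw : a * Q u x + b * Q u y = 0)
      (hw : a ^ 2 * Q x x + 2 * a * b * Q x y + b ^ 2 * Q y y = 0) (z : V) :
      a * Q x z + b * Q y z = 0 := by
    have h := apply_eq_zero_of_isotropic_of_orthogonal_pos Q hQsymm hQone
      (w := a • x + b • y) hu (by simpa using huw)
      (by
        simp only [map_add, map_smul, LinearMap.add_apply, LinearMap.smul_apply, smul_eq_mul,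
          hQsymm y x]
        linarith) z
    simpa using h
  rcases hx.eq_or_lt with hx0 | hx0
  · rcases hy.eq_or_lt with hy0 | hy0
    · have hxy0 : Q x y = 0 := by simpa [← hx0] using hxy
      obtain ⟨v, hv⟩ := hQpos
      by_cases hvx : Q v x = 0
      · exact ⟨1, 0, Or.inl one_ne_zero, radical hv 1 0 (by simp [hvx]) (by simp [← hx0])⟩
      · exact ⟨Q v y, -Q v x, Or.inr (neg_ne_zero.mpr hvx),
          radical hv _ _ (by ring) (by simp [← hx0, ← hy0, hxy0])⟩
    · exact ⟨Q y y, -Q x y, Or.inl hy0.ne', radical hy0 _ _ (by rw [hQsymm y x]; ring)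
        (by linear_combination -Q y y * hxy)⟩
  · exact ⟨-Q x y, Q x x, Or.inr hx0.ne', radical hx0 _ _ (by ring)
      (by linear_combination -Q x x * hxy)⟩
end

section
/- Let F be a C-Lorentzian symmetric n-multilinear form (n ≥ 2) on a finite-dimensional real vector space V, where C ⊆ V is a nonempty open convex cone with closure C̄. Let L₁, ..., L_{n−2} ∈ C̄ and let α, γ ∈ C̄ satisfy F(α,γ,L₁,...,L_{n−2})² = F(α,α,L₁,...,L_{n−2})·F(γ,γ,L₁,...,L_{n−2}). Then the linear forms v ↦ F(α,v,L₁,...,L_{n−2}) and v ↦ F(γ,v,L₁,...,L_{n−2}) on V are linearly dependent (proportional). -/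
/-- `biEval F v x y` is `F` evaluated with first argument `x`, second argument `y`, and the
remaining arguments `v 2, ..., v (n-1)`. -/
noncomputable def biEval {V : Type*} [AddCommGroup V] [Module ℝ V] {n : ℕ}
    (F : MultilinearMap ℝ (fun _ : Fin n => V) ℝ) (v : Fin n → V) (x y : V) : ℝ :=
  F (fun i => if (i : ℕ) = 0 then x else if (i : ℕ) = 1 then y else v i)

/-- `evalKer F L x y` is `F(L 1, ..., L (n-2), x, y)`. -/
noncomputable def evalKer {V : Type*} [AddCommGroup V] [Module ℝ V] {n : ℕ}
    (F : MultilinearMap ℝ (fun _ : Fin n => V) ℝ) (L : Fin (n - 2) → V) (x y : V) : ℝ :=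
  F (fun i => if h : (i : ℕ) < n - 2 then L ⟨(i : ℕ), h⟩
    else if (i : ℕ) = n - 2 then x else y)

namespace LinearMap.BilinForm

variable {V : Type*} [AddCommGroup V] [Module ℝ V] {B : LinearMap.BilinForm ℝ V}

/-- If the positive definite subspaces of `B` have dimension at most one, then `B` satisfies the
reversed Cauchy-Schwarz inequality. -/
lemma mul_le_sq_of_finrank_le_one [FiniteDimensional ℝ V] (hB : ∀ x y, B x y = B y x)
    (hW : ∀ W : Submodule ℝ V, (∀ ξ ∈ W, ξ ≠ 0 → 0 < B ξ ξ) → Module.finrank ℝ W ≤ 1)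
    {x : V} (hx : 0 < B x x) (y : V) : B x x * B y y ≤ B x y ^ 2 := by
  by_contra! h
  have expand (a b : ℝ) : B x x * B (a • x + b • y) (a • x + b • y) =
      (a * B x x + b * B x y) ^ 2 + b ^ 2 * (B x x * B y y - B x y ^ 2) := by
    simp only [map_add, map_smul, LinearMap.add_apply, LinearMap.smul_apply, smul_eq_mul, hB y x]
    ring
  have pos (a b : ℝ) (hab : a ≠ 0 ∨ b ≠ 0) : 0 < B (a • x + b • y) (a • x + b • y) := by
    refine pos_of_mul_pos_right ?_ hx.le
    rw [expand]
    have hd : 0 < B x x * B y y - B x y ^ 2 := sub_pos.2 h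
    by_cases hb : b = 0
    · have ha : a ≠ 0 := by tauto
      subst hb
      simp only [zero_mul, add_zero]
      positivity
    · positivity
  have ind : LinearIndependent ℝ ![x, y] := by
    rw [LinearIndependent.pair_iff]
    intro a b hab
    by_contra hne
    have := pos a b (by tauto)
    simp [hab] at this
  have hdim := finrank_span_eq_card ind
  have hle := hW (Submodule.span ℝ (Set.range ![x, y])) fun ξ hξ hne => by
    rw [Matrix.range_cons, Matrix.range_cons, Matrix.range_empty, Set.union_empty,
      Set.singleton_union, Submodule.mem_span_pair] at hξ
    obtain ⟨a, b, rfl⟩ := hξ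
    refine pos a b ?_
    by_contra! hab
    simp [hab.1, hab.2] at hne
  simp only [Fintype.card_fin] at hdim
  omega

/-- An isotropic vector orthogonal to a positive vector lies in the kernel. -/
lemma apply_eq_zero_of_isotropic (hB : ∀ x y, B x y = B y x) {u w : V}
    (hrev : ∀ y, B u u * B y y ≤ B u y ^ 2) (hu : 0 < B u u) (huw : B u w = 0)
    (hw : B w w = 0) (v : V) : B w v = 0 := by
  by_contra hne
  have key (t : ℝ) : B u u * (B v v + t * (2 * B w v)) ≤ B u v ^ 2 := by
    have := hrev (v + t • w)
    simp only [map_add, map_smul, LinearMap.add_apply, LinearMap.smul_apply, smul_eq_mul, huw, hw,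
      hB v w] at this
    linarith
  have := key ((B u v ^ 2 / B u u - B v v + 1) / (2 * B w v))
  rw [div_mul_cancel₀ _ (by simpa using hne)] at this
  have h2 : B u u * (B v v + (B u v ^ 2 / B u u - B v v + 1)) = B u v ^ 2 + B u u := by
    field_simp
    ring
  linarith

/-- An isotropic vector of a negative semidefinite form lies in the kernel. -/
lemma apply_eq_zero_of_nonpos (hB : ∀ x y, B x y = B y x) (hneg : ∀ x, B x x ≤ 0) {w : V}
    (hw : B w w = 0) (v : V) : B w v = 0 := by
  have h := hneg ((1 - B v v) • w + B w v • v)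
  simp only [map_add, map_smul, LinearMap.add_apply, LinearMap.smul_apply, smul_eq_mul, hw,
    hB v w] at h
  have hv := hneg v
  nlinarith [sq_nonneg (B w v), mul_nonneg (sq_nonneg (B w v)) (neg_nonneg.2 hv)]

/-- Equality in the reversed Cauchy-Schwarz inequality forces proportionality. -/
lemma exists_linear_relation (hB : ∀ x y, B x y = B y x)
    (hrev : ∀ x, 0 < B x x → ∀ y, B x x * B y y ≤ B x y ^ 2) {α γ : V}
    (hα : 0 ≤ B α α) (hγ : 0 ≤ B γ γ) (heq : B α γ ^ 2 = B α α * B γ γ) :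
    ∃ a b : ℝ, (a ≠ 0 ∨ b ≠ 0) ∧ ∀ v, a * B α v + b * B γ v = 0 := by
  have of_ker {a b : ℝ} (hab : a ≠ 0 ∨ b ≠ 0) {u : V} (hu : 0 < B u u)
      (h1 : B u (a • α + b • γ) = 0) (h2 : B (a • α + b • γ) (a • α + b • γ) = 0) :
      ∃ a b : ℝ, (a ≠ 0 ∨ b ≠ 0) ∧ ∀ v, a * B α v + b * B γ v = 0 :=
    ⟨a, b, hab, fun v => by
      simpa using apply_eq_zero_of_isotropic hB (hrev u hu) hu h1 h2 v⟩
  have expand (a b : ℝ) : B (a • α + b • γ) (a • α + b • γ) =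
      a ^ 2 * B α α + 2 * a * b * B α γ + b ^ 2 * B γ γ := by
    simp only [map_add, map_smul, LinearMap.add_apply, LinearMap.smul_apply, smul_eq_mul, hB γ α]
    ring
  rcases hα.lt_or_eq with hα | hα
  · refine of_ker (a := -B α γ) (b := B α α) (Or.inr hα.ne') hα ?_ ?_
    · simp only [map_add, map_smul, smul_eq_mul]
      ring
    · rw [expand]
      linear_combination (-B α α) * heq
  rcases hγ.lt_or_eq with hγ | hγ
  · refine of_ker (a := B γ γ) (b := -B α γ) (Or.inl hγ.ne') hγ ?_ ?_
    · simp only [map_add, map_smul, smul_eq_mul, hB γ α]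
      ring
    · rw [expand]
      linear_combination (-B γ γ) * heq
  have hαγ : B α γ = 0 := by simpa [← hα] using heq
  have iso (a b : ℝ) : B (a • α + b • γ) (a • α + b • γ) = 0 := by
    rw [expand, ← hα, ← hγ, hαγ]
    ring
  by_cases hpos : ∃ u, 0 < B u u
  · obtain ⟨u, hu⟩ := hpos
    by_cases h : B u α = 0
    · exact of_ker (a := 1) (b := 0) (Or.inl one_ne_zero) hu (by simp [h]) (iso _ _)
    · refine of_ker (a := B u γ) (b := -B u α) (Or.inr (neg_ne_zero.2 h)) hu ?_ (iso _ _)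
      simp only [map_add, map_smul, smul_eq_mul]
      ring
  · push Not at hpos
    exact ⟨1, 0, Or.inl one_ne_zero, fun v => by
      simp [apply_eq_zero_of_nonpos hB hpos hα.symm v]⟩

end LinearMap.BilinForm

/-- A multilinear form in finitely many variables from a finite-dimensional space is continuous. -/
lemma MultilinearMap.continuous_of_finiteDimensional {ι V : Type*} [Fintype ι]
    [NormedAddCommGroup V] [NormedSpace ℝ V] [FiniteDimensional ℝ V]
    (F : MultilinearMap ℝ (fun _ : ι => V) ℝ) : Continuous F := by
  classical
  let b := Module.finBasis ℝ V
  have h (w : ι → V) :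
      F w = ∑ r : ι → Fin (Module.finrank ℝ V), (∏ i, b.coord (r i) (w i)) •
        F fun i => b (r i) := by
    conv_lhs => rw [show w = fun i => ∑ j, b.coord j (w i) • b j from
      funext fun i => (b.sum_repr (w i)).symm]
    simp only [F.map_sum, F.map_smul_univ]
  have hb (j) : Continuous (b.coord j) := (b.coord j).continuous_of_finiteDimensional
  rw [show (F : (ι → V) → ℝ) = _ from funext h]
  fun_prop

section EvalKer

variable {V : Type*} [AddCommGroup V] [Module ℝ V] {n : ℕ}
  {F : MultilinearMap ℝ (fun _ : Fin n => V) ℝ}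

lemma evalKer_comm (hFsymm : ∀ (σ : Equiv.Perm (Fin n)) (v : Fin n → V), F (v ∘ σ) = F v)
    (hn : 2 ≤ n) (L : Fin (n - 2) → V) (x y : V) : evalKer F L x y = evalKer F L y x := by
  unfold evalKer
  rw [← hFsymm (Equiv.swap ⟨n - 2, by omega⟩ ⟨n - 1, by omega⟩)]
  congr 1
  funext i
  simp only [Function.comp_apply, Equiv.swap_apply_def, Fin.ext_iff]
  split_ifs <;> first | rfl | (exfalso; simp_all; done) | (exfalso; simp_all; omega)

lemma evalKer_eq_update (hn : 2 ≤ n) (L : Fin (n - 2) → V) (x y : V) :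
    evalKer F L x y = F (Function.update
      (fun i => if h : (i : ℕ) < n - 2 then L ⟨(i : ℕ), h⟩ else x) ⟨n - 1, by omega⟩ y) := by
  unfold evalKer
  congr 1
  funext i
  simp only [Function.update_apply, Fin.ext_iff]
  split_ifs <;> first | rfl | omega

/-- `evalKer F L` as a bilinear form, for symmetric `F`. -/
noncomputable def evalKerBilin
    (hFsymm : ∀ (σ : Equiv.Perm (Fin n)) (v : Fin n → V), F (v ∘ σ) = F v)
    (hn : 2 ≤ n) (L : Fin (n - 2) → V) : LinearMap.BilinForm ℝ V :=
  have add (x y z : V) : evalKer F L x (y + z) = evalKer F L x y + evalKer F L x z := by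
    simp only [evalKer_eq_update hn, MultilinearMap.map_update_add]
  have smul (c : ℝ) (x y : V) : evalKer F L x (c • y) = c • evalKer F L x y := by
    simp only [evalKer_eq_update hn, MultilinearMap.map_update_smul]
  LinearMap.mk₂ ℝ (evalKer F L)
    (fun x y z => by simp only [evalKer_comm hFsymm hn L _ z, add])
    (fun c x y => by simp only [evalKer_comm hFsymm hn L _ y, smul])
    add smul

lemma evalKer_eq_biEval (hFsymm : ∀ (σ : Equiv.Perm (Fin n)) (v : Fin n → V), F (v ∘ σ) = F v)
    (hn : 2 ≤ n) (L : Fin (n - 2) → V) (x y : V) :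
    evalKer F L x y =
      biEval F (fun i => if h : 2 ≤ (i : ℕ) then L ⟨i - 2, by omega⟩ else 0) x y := by
  obtain ⟨k, rfl⟩ := Nat.exists_eq_add_of_le' hn
  unfold evalKer biEval
  rw [← hFsymm (Equiv.addRight (Fin.ofNat (k + 2) 2)) fun i : Fin (k + 2) => ite _ _ _]
  congr 1
  funext i
  have hval : ((i + Fin.ofNat (k + 2) 2 : Fin (k + 2)) : ℕ) = (i + 2) % (k + 2) := by
    rw [Fin.val_add, Fin.val_ofNat, Nat.add_mod_mod]
  simp only [Function.comp_apply, Equiv.coe_addRight, hval]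
  by_cases h : (i : ℕ) < k
  · simp [Nat.mod_eq_of_lt (show (i : ℕ) + 2 < k + 2 by omega), h]
  · have hmod : ((i : ℕ) + 2) % (k + 2) = i - k := by
      rw [Nat.mod_eq_sub_mod (by omega), Nat.mod_eq_of_lt (by omega)]
      omega
    simp only [hmod, Nat.add_sub_cancel, h, dif_neg, not_false_eq_true]
    split_ifs <;> first | rfl | omega

end EvalKer

/-- Let `F` be a `C`-Lorentzian symmetric `n`-multilinear form (`n ≥ 2`) on a
finite-dimensional real vector space `V`, where `C ⊆ V` is a nonempty open convex cone. Let
`L₁, ..., L_{n-2}` and `α, γ` lie in the closure of `C` and assume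
`F(α,γ,L₁,...,L_{n-2})² = F(α,α,L₁,...,L_{n-2}) * F(γ,γ,L₁,...,L_{n-2})`. Then the linear
forms `v ↦ F(α,v,L₁,...,L_{n-2})` and `v ↦ F(γ,v,L₁,...,L_{n-2})` are linearly dependent. -/
theorem lorentzian_proportionality_of_equality
    {V : Type*} [NormedAddCommGroup V] [NormedSpace ℝ V] [FiniteDimensional ℝ V]
    {n : ℕ} (hn : 2 ≤ n)
    (C : Set V) (hCne : C.Nonempty) (hCopen : IsOpen C) (hCconv : Convex ℝ C)
    (hCcone : ∀ x ∈ C, ∀ t : ℝ, 0 < t → t • x ∈ C)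
    (F : MultilinearMap ℝ (fun _ : Fin n => V) ℝ)
    (hFsymm : ∀ (σ : Equiv.Perm (Fin n)) (v : Fin n → V), F (v ∘ σ) = F v)
    (hFpos : ∀ v : Fin n → V, (∀ i, v i ∈ C) → 0 < F v)
    (hFlor : ∀ v : Fin n → V, (∀ i : Fin n, 2 ≤ (i : ℕ) → v i ∈ C) →
      (∃ ξ : V, 0 < biEval F v ξ ξ) ∧
      ∀ W : Submodule ℝ V, (∀ ξ ∈ W, ξ ≠ 0 → 0 < biEval F v ξ ξ) →
        Module.finrank ℝ W ≤ 1)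
    (L : Fin (n - 2) → V) (hL : ∀ i, L i ∈ closure C)
    (α γ : V) (hα : α ∈ closure C) (hγ : γ ∈ closure C)
    (heq : evalKer F L α γ ^ 2 = evalKer F L α α * evalKer F L γ γ) :
    ∃ a b : ℝ, (a ≠ 0 ∨ b ≠ 0) ∧ ∀ v : V, a * evalKer F L α v + b * evalKer F L γ v = 0 := by
  have hFcont : Continuous F := F.continuous_of_finiteDimensional
  have hclosure {m : ℕ} {w : Fin m → V} (hw : ∀ i, w i ∈ closure C) :
      w ∈ closure (Set.univ.pi fun _ => C) := by
    rw [closure_pi_set]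
    exact fun i _ => hw i
  have hnonneg (w : Fin n → V) (hw : ∀ i, w i ∈ closure C) : 0 ≤ F w :=
    closure_minimal (s := Set.univ.pi fun _ => C) (t := {v : Fin n → V | 0 ≤ F v})
      (fun v hv => (hFpos v fun i => hv i trivial).le)
      (isClosed_le continuous_const hFcont) (hclosure hw)
  have hnonneg_diag (x : V) (hx : x ∈ closure C) : 0 ≤ evalKer F L x x := by
    refine hnonneg _ fun i => ?_
    split_ifs
    exacts [hL _, hx, hx]
  have hcont (x y : V) : Continuous fun L => evalKer F L x y := by
    refine hFcont.comp (continuous_pi fun i => ?_)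
    split_ifs <;> fun_prop
  have hrev (x y : V) (hx : 0 < evalKer F L x x) :
      evalKer F L x x * evalKer F L y y ≤ evalKer F L x y ^ 2 := by
    by_contra! h
    have hopen : IsOpen {L | 0 < evalKer F L x x ∧
        evalKer F L x y ^ 2 < evalKer F L x x * evalKer F L y y} :=
      (isOpen_lt continuous_const (hcont x x)).inter
        (isOpen_lt ((hcont x y).pow 2) ((hcont x x).mul (hcont y y)))
    obtain ⟨M, ⟨hMx, hMxy⟩, hM⟩ := mem_closure_iff.1 (hclosure hL) _ hopen ⟨hx, h⟩
    refine hMxy.not_ge (LinearMap.BilinForm.mul_le_sq_of_finrank_le_one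
      (B := evalKerBilin hFsymm hn M) (evalKer_comm hFsymm hn M) (fun W hW => ?_) hMx y)
    refine (hFlor (fun i => if h : 2 ≤ (i : ℕ) then M ⟨i - 2, by omega⟩ else 0)
      fun i hi => ?_).2 W fun ξ hξ hne => ?_
    · simp only [hi, dif_pos]
      exact hM _ trivial
    · rw [← evalKer_eq_biEval hFsymm hn]
      exact hW ξ hξ hne
  exact LinearMap.BilinForm.exists_linear_relation (B := evalKerBilin hFsymm hn L)
    (evalKer_comm hFsymm hn L) (fun x hx y => hrev x y hx) (hnonneg_diag α hα)
    (hnonneg_diag γ hγ) heq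
end

section
/- Let F be a C-Lorentzian symmetric n-multilinear form (n ≥ 3) on a finite-dimensional real vector space V, where C ⊆ V is a nonempty open convex cone with closure C̄. Let L₁, ..., L_{n−2} ∈ C̄ be a subcritical collection, i.e. nd(L_I) ≥ |I| for every nonempty I ⊆ [n−2], and assume the collection is not critical, i.e. there is a nonempty I₀ ⊆ [n−2] with nd(L_{I₀}) = |I₀|. Then for every i ∈ I₀ one has F(L₁,...,L_{n−2}, L_i, v) = 0 for all v ∈ V; in particular the kernel of the linear map v ↦ F(L₁,...,L_{n−2}, v, ·) is nontrivial. -/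
/-- `numDim F w v = max {k ∈ {0,...,n} : F(v[k], w[n-k]) > 0}`, the numerical dimension of `v`
computed with respect to `w` (independent of the choice of `w ∈ C`). -/
noncomputable def numDim {V : Type*} [AddCommGroup V] [Module ℝ V] {n : ℕ}
    (F : MultilinearMap ℝ (fun _ : Fin n => V) ℝ) (w v : V) : ℕ :=
  sSup {k : ℕ | k ≤ n ∧ 0 < F (fun i => if (i : ℕ) < k then v else w)}

namespace MultilinearMap

variable {ι V : Type*} [NormedAddCommGroup V] [NormedSpace ℝ V]
  {F : MultilinearMap ℝ (fun _ : ι => V) ℝ} {C : Set V}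

/-- A multilinear form that is positive on tuples from `C` is nonnegative on tuples from the
closure of `C`. -/
theorem nonneg_of_mem_closure [FiniteDimensional ℝ V] [Fintype ι]
    (hF : ∀ v : ι → V, (∀ i, v i ∈ C) → 0 < F v)
    {a : ι → V} (ha : ∀ i, a i ∈ closure C) : 0 ≤ F a := by
  classical
  suffices h : ∀ s : Finset ι, ∀ a : ι → V, (∀ i ∈ s, a i ∈ closure C) → (∀ i ∉ s, a i ∈ C) →
      0 ≤ F a from h Finset.univ a (fun i _ => ha i) (by simp)
  intro s
  induction s using Finset.induction_on with
  | empty => exact fun a _ h => (hF a fun i => h i (by simp)).le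
  | insert i s his ih =>
    intro a h₁ h₂
    have hcont : Continuous (F.toLinearMap a i) := LinearMap.continuous_of_finiteDimensional _
    have hsub : closure C ⊆ {x | 0 ≤ F.toLinearMap a i x} := by
      refine closure_minimal (fun x hx => ?_) (isClosed_le continuous_const hcont)
      refine ih (Function.update a i x) (fun j hj => ?_) (fun j hj => ?_)
      · rw [Function.update_of_ne (by rintro rfl; exact his hj)]
        exact h₁ j (Finset.mem_insert_of_mem hj)
      · by_cases hji : j = i
        · subst hji; simpa using hx
        · rw [Function.update_of_ne hji]
          exact h₂ j (by simp [hji, hj])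
    simpa using hsub (h₁ i (Finset.mem_insert_self i s))

/-- A multilinear form that is nonnegative on tuples from `K` is monotone on such tuples for the
order defined by `K`. -/
theorem le_of_sub_mem [Fintype ι] {K : Set V}
    (hF : ∀ v : ι → V, (∀ i, v i ∈ K) → 0 ≤ F v)
    {a b : ι → V} (ha : ∀ i, a i ∈ K) (hab : ∀ i, b i - a i ∈ K) : F a ≤ F b := by
  classical
  have hb : b = a + (b - a) := by abel
  rw [hb, F.map_add_univ]
  have h := Finset.single_le_sum (f := fun s : Finset ι => F (s.piecewise a (b - a)))
    (fun s _ => hF _ fun i => ?_) (Finset.mem_univ Finset.univ)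
  · simpa using h
  · by_cases hi : i ∈ s
    · simpa [hi] using ha i
    · simpa [hi] using hab i

end MultilinearMap

/-- Every vector is absorbed by a positive multiple of a point of an open cone. -/
theorem IsOpen.exists_smul_sub_mem {V : Type*} [NormedAddCommGroup V] [NormedSpace ℝ V]
    {C : Set V} (hC : IsOpen C) (hcone : ∀ x ∈ C, ∀ t : ℝ, 0 < t → t • x ∈ C)
    {w : V} (hw : w ∈ C) (x : V) : ∃ t : ℝ, 0 < t ∧ t • w - x ∈ C := by
  have hcont : ContinuousAt (fun ε : ℝ => w - ε • x) 0 := by fun_prop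
  have hev : ∀ᶠ ε in nhdsWithin (0 : ℝ) (Set.Ioi 0), w - ε • x ∈ C :=
    (hcont.eventually (hC.mem_nhds (by simpa using hw))).filter_mono nhdsWithin_le_nhds
  obtain ⟨ε, hε, hpos⟩ := (hev.and self_mem_nhdsWithin).exists
  have hpos' : (0 : ℝ) < ε := hpos
  refine ⟨ε⁻¹, inv_pos.2 hpos', ?_⟩
  have := hcone _ hε ε⁻¹ (inv_pos.2 hpos')
  rwa [smul_sub, smul_smul, inv_mul_cancel₀ hpos'.ne', one_smul] at this

/-- The value of a symmetric form at a tuple of `u`s and `w`s depends only on the number of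
`u`s. -/
theorem map_ite_mem_eq_of_symm {V M : Type*} {n : ℕ} {F : (Fin n → V) → M}
    (hF : ∀ (σ : Equiv.Perm (Fin n)) (v : Fin n → V), F (v ∘ σ) = F v)
    (u w : V) (P : Finset (Fin n)) :
    F (fun i => if i ∈ P then u else w) = F (fun i => if (i : ℕ) < P.card then u else w) := by
  classical
  have hP : P.card ≤ n := by simpa using P.card_le_univ
  have hcard : Fintype.card {i // i ∈ P} = Fintype.card {i : Fin n // (i : ℕ) < P.card} := by
    rw [Fintype.card_coe, Fintype.card_subtype, Fin.card_filter_val_lt, min_eq_right hP]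
  let e := Fintype.equivOfCardEq hcard
  rw [← hF e.extendSubtype fun i => if (i : ℕ) < P.card then u else w]
  congr 1
  funext i
  by_cases hi : i ∈ P
  · have h : ((e.extendSubtype i : Fin n) : ℕ) < P.card := e.extendSubtype_mem i hi
    simp [hi, h]
  · have h : ¬ ((e.extendSubtype i : Fin n) : ℕ) < P.card := e.extendSubtype_not_mem i hi
    simp only [Function.comp_apply, if_neg hi, if_neg h]

section NumDim

variable {V : Type*} [AddCommGroup V] [Module ℝ V] {n : ℕ}
  {F : MultilinearMap ℝ (fun _ : Fin n => V) ℝ} {w v : V}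

theorem le_numDim {k : ℕ} (hk : k ≤ n) (h : 0 < F (fun i => if (i : ℕ) < k then v else w)) :
    k ≤ numDim F w v :=
  le_csSup ⟨n, fun _ hj => hj.1⟩ ⟨hk, h⟩

theorem ne_zero_of_one_le_numDim (h : 1 ≤ numDim F w v) : v ≠ 0 := by
  rintro rfl
  refine absurd h (not_le.2 (Nat.lt_one_iff.2 (Nat.le_zero.1 (csSup_le' fun k hk => ?_))))
  by_contra hk0
  have hk0 : 0 < k := Nat.pos_of_ne_zero (by simpa using hk0)
  have : F (fun i => if (i : ℕ) < k then 0 else w) = 0 :=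
    F.map_coord_zero ⟨0, hk0.trans_le hk.1⟩ (by simp [hk0])
  exact hk.2.ne' this

end NumDim

/-- Let `F` be a `C`-Lorentzian symmetric `n`-multilinear form (`n ≥ 3`).
Let `L₁, ..., L_{n-2}` in the closure of `C` be a subcritical collection (`nd(L_I) ≥ |I|` for
every nonempty `I`), which is not critical: there is a nonempty `I₀` with `nd(L_{I₀}) = |I₀|`.
Then for every `i ∈ I₀`, `F(L₁,...,L_{n-2}, L_i, v) = 0` for all `v ∈ V`; in particular the
kernel of the linear map `v ↦ F(L₁,...,L_{n-2}, v, ·)` is nontrivial. -/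
theorem kernel_nontrivial_of_not_critical
    {V : Type*} [NormedAddCommGroup V] [NormedSpace ℝ V] [FiniteDimensional ℝ V]
    {n : ℕ} (hn : 3 ≤ n)
    (C : Set V) (hCne : C.Nonempty) (hCopen : IsOpen C) (hCconv : Convex ℝ C)
    (hCcone : ∀ x ∈ C, ∀ t : ℝ, 0 < t → t • x ∈ C)
    (F : MultilinearMap ℝ (fun _ : Fin n => V) ℝ)
    (hFsymm : ∀ (σ : Equiv.Perm (Fin n)) (v : Fin n → V), F (v ∘ σ) = F v)
    (hFpos : ∀ v : Fin n → V, (∀ i, v i ∈ C) → 0 < F v)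
    (hFlor : ∀ v : Fin n → V, (∀ i : Fin n, 2 ≤ (i : ℕ) → v i ∈ C) →
      (∃ ξ : V, 0 < biEval F v ξ ξ) ∧
      ∀ W : Submodule ℝ V, (∀ ξ ∈ W, ξ ≠ 0 → 0 < biEval F v ξ ξ) →
        Module.finrank ℝ W ≤ 1)
    (w : V) (hw : w ∈ C)
    (L : Fin (n - 2) → V) (hL : ∀ i, L i ∈ closure C)
    (hsub : ∀ I : Finset (Fin (n - 2)), I.Nonempty → I.card ≤ numDim F w (∑ i ∈ I, L i))
    (I₀ : Finset (Fin (n - 2))) (hI₀ : I₀.Nonempty)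
    (hI₀sub : numDim F w (∑ i ∈ I₀, L i) = I₀.card) :
    (∀ i ∈ I₀, ∀ v : V, evalKer F L (L i) v = 0) ∧
      ∃ η : V, η ≠ 0 ∧ ∀ v : V, evalKer F L η v = 0 := by
  classical
  let K : ConvexCone ℝ V := ⟨C, fun c hc x hx => hCcone x hx c hc, fun x hx y hy => by
    have h := hCcone _ (hCconv hx hy (by norm_num : (0 : ℝ) ≤ 1 / 2)
      (by norm_num : (0 : ℝ) ≤ 1 / 2) (by norm_num)) 2 (by norm_num)
    rwa [← smul_add, smul_smul, mul_one_div_cancel two_ne_zero, one_smul] at h⟩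
  have hadd : ∀ x ∈ closure C, ∀ y ∈ closure C, x + y ∈ closure C :=
    fun x hx y hy => K.closure.add_mem hx hy
  have hzero : (0 : V) ∈ closure C := by
    have hcont : ContinuousWithinAt (fun t : ℝ => t • w) (Set.Ioi 0) 0 := by fun_prop
    refine mem_closure_of_tendsto (f := fun t : ℝ => t • w) (b := nhdsWithin 0 (Set.Ioi 0))
      (by simpa [ContinuousWithinAt] using hcont) ?_
    filter_upwards [self_mem_nhdsWithin] with t ht using hCcone w hw t ht
  have hsum : ∀ I : Finset (Fin (n - 2)), ∑ i ∈ I, L i ∈ closure C := fun I =>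
    Finset.sum_induction L (· ∈ closure C) (fun x y hx hy => hadd x hx y hy) hzero fun i _ => hL i
  have hnonneg : ∀ v : Fin n → V, (∀ i, v i ∈ closure C) → 0 ≤ F v := fun v hv =>
    MultilinearMap.nonneg_of_mem_closure hFpos hv
  set S := ∑ i ∈ I₀, L i with hS
  have hSL : ∀ i ∈ I₀, S - L i ∈ closure C := fun i hi => by
    rw [hS, ← Finset.sum_erase_eq_sub hi]
    exact hsum _
  have hcard : I₀.card ≤ n - 2 := by simpa using I₀.card_le_univ
  have hvanish : F (fun j => if (j : ℕ) < I₀.card + 1 then S else w) = 0 := by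
    refine le_antisymm (not_lt.1 fun h => ?_) (hnonneg _ fun j => ?_)
    · have := le_numDim (by omega) h
      omega
    · split_ifs
      exacts [hsum I₀, subset_closure hw]
  have hC : ∀ i ∈ I₀, ∀ v ∈ C, evalKer F L (L i) v = 0 := by
    intro i hi v hv
    let ℓ : Fin (n - 2) ↪ Fin n := Fin.castLEEmb (Nat.sub_le n 2)
    let p : Fin n := ⟨n - 2, by omega⟩
    have hp : p ∉ I₀.map ℓ := by
      simp only [Finset.mem_map, not_exists, not_and]
      intro j _ h
      have := congrArg Fin.val h
      simp only [ℓ, p, Fin.castLEEmb_apply, Fin.val_castLE] at this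
      omega
    let P : Finset (Fin n) := insert p (I₀.map ℓ)
    have hPcard : P.card = I₀.card + 1 := by
      rw [Finset.card_insert_of_notMem hp, Finset.card_map]
    have hbase : F (fun j => if j ∈ P then S else w) = 0 := by
      rw [map_ite_mem_eq_of_symm hFsymm, hPcard, hvanish]
    let a : Fin n → V := fun j => if h : (j : ℕ) < n - 2 then L ⟨(j : ℕ), h⟩
      else if (j : ℕ) = n - 2 then L i else v
    have ha : ∀ j, a j ∈ closure C := fun j => by
      simp only [a]
      split_ifs
      exacts [hL _, hL _, subset_closure hv]
    have haS : ∀ j ∈ P, S - a j ∈ closure C := by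
      intro j hj
      rcases Finset.mem_insert.1 hj with rfl | hj
      · simpa [a, p] using hSL i hi
      · obtain ⟨m, hm, rfl⟩ := Finset.mem_map.1 hj
        simpa [a, ℓ] using hSL m hm
    choose t _ ht using fun j => hCopen.exists_smul_sub_mem hCcone hw (a j)
    have hle : F a ≤ F (fun j => (if j ∈ P then 1 else t j) • (if j ∈ P then S else w)) := by
      refine MultilinearMap.le_of_sub_mem hnonneg ha fun j => ?_
      by_cases hj : j ∈ P
      · simpa [hj] using haS j hj
      · simpa [hj] using subset_closure (ht j)
    rw [F.map_smul_univ (fun j => if j ∈ P then 1 else t j), hbase, smul_zero] at hle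
    exact le_antisymm hle (hnonneg a ha)
  have hker : ∀ i ∈ I₀, ∀ v : V, evalKer F L (L i) v = 0 := by
    intro i hi v
    let q : Fin n := ⟨n - 1, by omega⟩
    let f : V →ₗ[ℝ] ℝ := F.toLinearMap (fun j => if h : (j : ℕ) < n - 2 then L ⟨(j : ℕ), h⟩
      else if (j : ℕ) = n - 2 then L i else 0) q
    have hf : ∀ x, evalKer F L (L i) x = f x := by
      intro x
      simp only [evalKer, f, MultilinearMap.toLinearMap_apply]
      congr 1
      funext j
      by_cases hj : j = q
      · subst hj
        have h₁ : ¬ n - 1 < n - 2 := by omega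
        have h₂ : n - 1 ≠ n - 2 := by omega
        simp [q, h₁, h₂]
      · have hj' : (j : ℕ) ≠ n - 1 := fun h => hj (Fin.ext h)
        rw [Function.update_of_ne hj]
        split_ifs
        · rfl
        · rfl
        · omega
    obtain ⟨t, -, ht⟩ := hCopen.exists_smul_sub_mem hCcone hw v
    have h₁ := hC i hi _ ht
    have h₂ := hC i hi _ hw
    rw [hf] at h₁ h₂ ⊢
    rw [map_sub, map_smul, h₂, smul_zero, zero_sub, neg_eq_zero] at h₁
    exact h₁
  refine ⟨hker, ?_⟩
  obtain ⟨i, hi⟩ := hI₀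
  refine ⟨L i, ne_zero_of_one_le_numDim (F := F) (w := w) ?_, hker i hi⟩
  simpa using hsub {i} (Finset.singleton_nonempty i)
end

section
/- Let F be a C-Lorentzian symmetric n-multilinear form (n ≥ 3) on a finite-dimensional real vector space V, where C ⊆ V is a nonempty open convex cone with closure C̄. Let L₁, ..., L_{n−2} ∈ C̄ be a subcritical collection, i.e. nd(L_I) ≥ |I| for every nonempty I ⊆ [n−2]. Let M be the union of all subcritical subsets of [n−2] (subsets I with nd(L_I) = |I|). Then the remaining collection is critical relative to M in the following sense: for every nonempty I ⊆ [n−2] \ M and every ω ∈ C, F evaluated at |I|+1 copies of L_I, the classes L_m for m ∈ M, and n − |I| − 1 − |M| copies of ω is strictly positive. -/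
/-- Two tuples with the same underlying multiset agree up to a permutation on each side. -/
theorem exists_comp_perm_eq_of_ofFn_perm {α : Type*} {n : ℕ} {f g : Fin n → α}
    (h : (List.ofFn f).Perm (List.ofFn g)) :
    ∃ σ τ : Equiv.Perm (Fin n), f ∘ σ = g ∘ τ := by
  classical
  let _ : LinearOrder α := linearOrderOfSTO WellOrderingRel
  refine ⟨Tuple.sort f, Tuple.sort g, List.ofFn_injective ?_⟩
  exact (((Tuple.sort f).ofFn_comp_perm f).trans
    (h.trans ((Tuple.sort g).ofFn_comp_perm g).symm)).eq_of_pairwise'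
      (Tuple.monotone_sort f).sortedLE_ofFn.pairwise (Tuple.monotone_sort g).sortedLE_ofFn.pairwise

theorem MultilinearMap.continuous_of_finiteDimensional_real {V ι : Type*} [NormedAddCommGroup V]
    [NormedSpace ℝ V] [FiniteDimensional ℝ V] [Fintype ι]
    (F : MultilinearMap ℝ (fun _ : ι => V) ℝ) : Continuous F := by
  classical
  let b := Module.finBasis ℝ V
  have h : ∀ f : ι → V, F f =
      ∑ r : ι → Fin (Module.finrank ℝ V), (∏ i, b.repr (f i) (r i)) • F (fun i => b (r i)) := by
    intro f
    conv_lhs => rw [show f = fun i => ∑ j, b.repr (f i) j • b j from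
      funext fun i => (b.sum_repr (f i)).symm]
    rw [F.map_sum]
    exact Finset.sum_congr rfl fun r _ => F.map_smul_univ _ _
  rw [show (F : (ι → V) → ℝ) = _ from funext h]
  have hc : ∀ j, Continuous fun v => b.repr v j := fun j =>
    (b.coord j).continuous_of_finiteDimensional
  refine continuous_finsetSum _ fun r _ => Continuous.fun_smul ?_ continuous_const
  exact continuous_finsetProd _ fun i _ => (hc (r i)).comp (continuous_apply i)

/-- A sub-multiset of the image of `s` is the image of a sub-multiset of `s`. -/
theorem Multiset.exists_le_map_eq_of_le_map {α β : Type*} {f : α → β} {s : Multiset α}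
    {t : Multiset β} (h : t ≤ s.map f) : ∃ u ≤ s, u.map f = t := by
  induction s using Quotient.inductionOn with | _ l =>
  induction t using Quotient.inductionOn with | _ l' =>
  obtain ⟨k, hk, hs⟩ : l'.Subperm (l.map f) := h
  obtain ⟨u, hu, rfl⟩ := List.sublist_map_iff.1 hs
  exact ⟨u, hu.subperm, Quotient.sound hk⟩

theorem Multiset.exists_ofFn_eq {α : Type*} {m : ℕ} {s : Multiset α} (hs : s.card = m) :
    ∃ f : Fin m → α, (List.ofFn f : Multiset α) = s := by
  subst hs
  refine ⟨fun i => s.toList.get (i.cast (by simp)), ?_⟩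
  conv_rhs => rw [← Multiset.coe_toList s]
  congr 1
  exact List.ext_getElem (by simp) fun i h₁ h₂ => by simp

theorem Multiset.forall_mem_add_replicate {α : Type*} {p : α → Prop} {s : Multiset α} {x : α}
    {r : ℕ} (h : ∀ z ∈ s, p z) (hx : p x) : ∀ z ∈ s + Multiset.replicate r x, p z := by
  intro z hz
  rcases Multiset.mem_add.1 hz with hz | hz
  · exact h z hz
  · exact Multiset.eq_of_mem_replicate hz ▸ hx

/-- The value of a symmetric multilinear form on a multiset of vectors. -/
noncomputable def symEval {V : Type*} [AddCommGroup V] [Module ℝ V] {n : ℕ}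
    (F : MultilinearMap ℝ (fun _ : Fin n => V) ℝ) (s : Multiset V) : ℝ :=
  F (fun i => s.toList.getD i 0)

/-- A symmetric multilinear form which is Lorentzian with respect to the open convex cone `C`. -/
structure IsLorentzianForm {V : Type*} [NormedAddCommGroup V] [NormedSpace ℝ V] {n : ℕ}
    (C : Set V) (F : MultilinearMap ℝ (fun _ : Fin n => V) ℝ) : Prop where
  isOpen : IsOpen C
  convex : Convex ℝ C
  smul_mem : ∀ x ∈ C, ∀ t : ℝ, 0 < t → t • x ∈ C
  symm : ∀ (σ : Equiv.Perm (Fin n)) (v : Fin n → V), F (v ∘ σ) = F v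
  pos : ∀ v : Fin n → V, (∀ i, v i ∈ C) → 0 < F v
  finrank_le : ∀ v : Fin n → V, (∀ i : Fin n, 2 ≤ (i : ℕ) → v i ∈ C) →
    ∀ W : Submodule ℝ V, (∀ ξ ∈ W, ξ ≠ 0 → 0 < biEval F v ξ ξ) → Module.finrank ℝ W ≤ 1

namespace IsLorentzianForm

variable {V : Type*} [NormedAddCommGroup V] [NormedSpace ℝ V] {n : ℕ}
  {C : Set V} {F : MultilinearMap ℝ (fun _ : Fin n => V) ℝ}

theorem apply_eq_symEval (hF : IsLorentzianForm C F) (f : Fin n → V) :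
    F f = symEval F (List.ofFn f) := by
  set l := (↑(List.ofFn f) : Multiset V).toList with hl
  have hp : l.Perm (List.ofFn f) := by
    rw [← Multiset.coe_eq_coe, hl, Multiset.coe_toList]
  have hlen : l.length = n := by simpa using hp.length_eq
  have hg : List.ofFn (fun i : Fin n => l.getD i 0) = l :=
    List.ext_getElem (by simp [hlen]) fun i h₁ h₂ => by simp [h₂]
  obtain ⟨σ, τ, h⟩ := exists_comp_perm_eq_of_ofFn_perm (f := f)
    (g := fun i : Fin n => l.getD i 0) (by rw [hg]; exact hp.symm)
  rw [symEval, ← hF.symm σ f, h, hF.symm]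

theorem exists_linearMap (hF : IsLorentzianForm C F) {s : Multiset V} (hs : s.card + 1 = n) :
    ∃ φ : V →ₗ[ℝ] ℝ, ∀ x, symEval F (x ::ₘ s) = φ x := by
  subst hs
  obtain ⟨g, hg⟩ := Multiset.exists_ofFn_eq (s := s) rfl
  refine ⟨⟨⟨fun x => F (Fin.cons x g), fun x y => F.cons_add g x y⟩,
    fun c x => F.cons_smul g c x⟩, fun x => ?_⟩
  change _ = F (Fin.cons x g)
  rw [hF.apply_eq_symEval, List.ofFn_cons, ← Multiset.cons_coe, hg]

theorem add_mem (hF : IsLorentzianForm C F) {x y : V} (hx : x ∈ C) (hy : y ∈ C) : x + y ∈ C := by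
  have h := hF.smul_mem _ (hF.convex hx hy (a := 1 / 2) (b := 1 / 2) (by norm_num) (by norm_num)
    (by norm_num)) 2 (by norm_num)
  simpa [smul_smul] using h

theorem add_mem_closure (hF : IsLorentzianForm C F) {x y : V} (hx : x ∈ closure C)
    (hy : y ∈ closure C) : x + y ∈ closure C :=
  map_mem_closure₂ continuous_add hx hy fun _ ha _ hb => hF.add_mem ha hb

theorem zero_mem_closure (hF : IsLorentzianForm C F) {w : V} (hw : w ∈ C) : 0 ∈ closure C := by
  have h : Filter.Tendsto (fun k : ℕ => (1 / ((k : ℝ) + 1)) • w) Filter.atTop (nhds ((0 : ℝ) • w)) :=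
    (tendsto_one_div_add_atTop_nhds_zero_nat (𝕜 := ℝ)).smul_const w
  rw [zero_smul] at h
  exact mem_closure_of_tendsto h
    (Filter.Eventually.of_forall fun k => hF.smul_mem w hw _ (by positivity))

theorem sum_mem_closure (hF : IsLorentzianForm C F) {w : V} (hw : w ∈ C) {s : Multiset V}
    (hs : ∀ x ∈ s, x ∈ closure C) : s.sum ∈ closure C :=
  Multiset.sum_induction (· ∈ closure C) s (fun _ _ => hF.add_mem_closure)
    (hF.zero_mem_closure hw) hs

/-- The reversed Cauchy–Schwarz inequality on the open cone. -/
theorem biEval_mul_le_sq (hF : IsLorentzianForm C F) (h2 : 2 ≤ n) {f : Fin n → V}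
    (hf : ∀ i, f i ∈ C) (x y : V) (hx : x ∈ C) :
    biEval F f x x * biEval F f y y ≤ biEval F f x y ^ 2 := by
  obtain ⟨m, rfl⟩ := Nat.exists_eq_add_of_le' h2
  have hb : ∀ a b, biEval F f a b = F (Fin.cons a (Fin.cons b fun i => f i.succ.succ)) := by
    intro a b
    rw [biEval]
    congr 1
    funext i
    refine Fin.cases ?_ (fun i => Fin.cases ?_ (fun i => ?_) i) i <;> simp
  have hsymm : ∀ a b, biEval F f a b = biEval F f b a := by
    intro a b
    rw [hb, hb, hF.apply_eq_symEval, hF.apply_eq_symEval]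
    simp only [List.ofFn_cons, ← Multiset.cons_coe]
    rw [Multiset.cons_swap]
  have hadd : ∀ a b c, biEval F f (a + b) c = biEval F f a c + biEval F f b c := by
    intro a b c; simp only [hb]; exact F.cons_add _ _ _
  have hsmul : ∀ (r : ℝ) a c, biEval F f (r • a) c = r * biEval F f a c := by
    intro r a c; simp only [hb]; exact F.cons_smul _ _ _
  have hquad : ∀ r s : ℝ, biEval F f (r • x + s • y) (r • x + s • y) =
      r ^ 2 * biEval F f x x + 2 * r * s * biEval F f x y + s ^ 2 * biEval F f y y := by
    intro r s
    rw [hadd, hsmul, hsmul, hsymm x, hsymm y (_ + _), hadd, hadd, hsmul, hsmul, hsmul, hsmul,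
      hsymm y x]
    ring
  have hpos : ∀ z ∈ C, 0 < biEval F f z z := by
    intro z hz
    refine hF.pos _ fun i => ?_
    split_ifs <;> simp_all
  by_contra! hlt
  have hdef : ∀ r s : ℝ, (r ≠ 0 ∨ s ≠ 0) →
      0 < biEval F f (r • x + s • y) (r • x + s • y) := by
    intro r s hrs
    rw [hquad]
    have hA := hpos x hx
    set a := biEval F f x x
    set c := biEval F f y y
    set b := biEval F f x y
    have key : a * (r ^ 2 * a + 2 * r * s * b + s ^ 2 * c) =
        (r * a + s * b) ^ 2 + s ^ 2 * (a * c - b ^ 2) := by ring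
    refine pos_of_mul_pos_right (a := a) ?_ hA.le
    rw [key]
    rcases eq_or_ne s 0 with rfl | hs
    · have : r ≠ 0 := by simpa using hrs
      have : 0 < (r * a) ^ 2 := by positivity
      simpa using this
    · have : 0 < s ^ 2 * (a * c - b ^ 2) := mul_pos (by positivity) (by linarith)
      positivity
  have hli : LinearIndependent ℝ ![x, y] := by
    rw [LinearIndependent.pair_iff]
    intro r s h0
    by_contra hne
    have h := hdef r s (by tauto)
    rw [h0] at h
    have hz := hsmul 0 0 0
    rw [zero_smul, zero_mul] at hz
    exact h.ne' hz
  have hfin := finrank_span_eq_card hli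
  have hle := hF.finrank_le f (fun i _ => hf i) (Submodule.span ℝ (Set.range ![x, y])) (by
    intro ξ hξ hne
    rw [Matrix.range_cons, Matrix.range_cons, Matrix.range_empty, Set.union_empty,
      Set.singleton_union, Submodule.mem_span_pair] at hξ
    obtain ⟨r, s, rfl⟩ := hξ
    refine hdef r s ?_
    by_contra! h
    simp [h.1, h.2] at hne)
  simp at hfin
  omega

/-- A positivity-preserving replacement may be applied to all copies of a vector. -/
theorem symEval_replicate_pos_of_forall {x y : V} (hx : x ∈ closure C) (hy : y ∈ closure C)
    (hxy : ∀ s : Multiset V, s.card + 1 = n → (∀ z ∈ s, z ∈ closure C) →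
      0 < symEval F (x ::ₘ s) → 0 < symEval F (y ::ₘ s)) (c : ℕ) :
    ∀ s : Multiset V, s.card + c = n → (∀ z ∈ s, z ∈ closure C) →
      0 < symEval F (Multiset.replicate c x + s) → 0 < symEval F (Multiset.replicate c y + s) := by
  induction c with
  | zero => intro s _ _ hp; simpa using hp
  | succ c ih =>
    intro s hs h hp
    rw [Multiset.replicate_succ, Multiset.cons_add] at hp ⊢
    refine hxy _ (by simp; omega) ?_ ?_
    · intro z hz
      rcases Multiset.mem_add.1 hz with hz | hz
      · exact Multiset.eq_of_mem_replicate hz ▸ hy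
      · exact h z hz
    · rw [← Multiset.add_cons] at hp ⊢
      exact ih _ (by simp; omega) (by simpa [Multiset.forall_mem_cons] using ⟨hx, h⟩) hp

variable [FiniteDimensional ℝ V]

theorem symEval_nonneg (hF : IsLorentzianForm C F) {s : Multiset V} (hs : s.card = n)
    (h : ∀ x ∈ s, x ∈ closure C) : 0 ≤ symEval F s := by
  obtain ⟨f, rfl⟩ := Multiset.exists_ofFn_eq hs
  rw [← hF.apply_eq_symEval]
  have hf : f ∈ closure (Set.pi Set.univ fun _ : Fin n => C) := by
    rw [closure_pi_set]
    exact fun i _ => h _ (by simp)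
  exact closure_minimal (t := {g | 0 ≤ F g}) (fun g hg => (hF.pos g fun i => Set.mem_univ_pi.1 hg i).le)
    (isClosed_le continuous_const F.continuous_of_finiteDimensional_real) hf

/-- The Alexandrov–Fenchel inequality on the closed cone. -/
theorem symEval_mul_le_sq (hF : IsLorentzianForm C F) {s : Multiset V} (hs : s.card + 2 = n)
    (h : ∀ x ∈ s, x ∈ closure C) {x y : V} (hx : x ∈ closure C) (hy : y ∈ closure C) :
    symEval F (x ::ₘ x ::ₘ s) * symEval F (y ::ₘ y ::ₘ s) ≤ symEval F (x ::ₘ y ::ₘ s) ^ 2 := by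
  subst hs
  obtain ⟨g, hg⟩ := Multiset.exists_ofFn_eq (s := s) rfl
  set f : Fin (s.card + 2) → V := Fin.cons x (Fin.cons y g) with hfdef
  have hf : f ∈ closure (Set.pi Set.univ fun _ : Fin (s.card + 2) => C) := by
    rw [closure_pi_set]
    rintro i -
    refine Fin.cases ?_ (fun i => Fin.cases ?_ (fun i => ?_) i) i
    · simpa [hfdef] using hx
    · simpa [hfdef] using hy
    · simpa [hfdef] using h _ (by rw [← hg]; simp)
  have hcont : ∀ i j : Fin (s.card + 2),
      Continuous fun f : Fin (s.card + 2) → V => biEval F f (f i) (f j) := by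
    intro i j
    refine F.continuous_of_finiteDimensional_real.comp (continuous_pi fun k => ?_)
    split_ifs <;> exact continuous_apply _
  have key := closure_minimal
    (t := {f | biEval F f (f 0) (f 0) * biEval F f (f 1) (f 1) ≤ biEval F f (f 0) (f 1) ^ 2})
    (fun f hf => hF.biEval_mul_le_sq (by omega) (Set.mem_univ_pi.1 hf) _ _
      (Set.mem_univ_pi.1 hf 0))
    (isClosed_le ((hcont 0 0).mul (hcont 1 1)) ((hcont 0 1).pow 2)) hf
  have hb : ∀ a b, biEval F f a b = symEval F (a ::ₘ b ::ₘ s) := by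
    intro a b
    have : biEval F f a b = F (Fin.cons a (Fin.cons b g)) := by
      rw [biEval]
      congr 1
      funext i
      refine Fin.cases ?_ (fun i => Fin.cases ?_ (fun i => ?_) i) i <;> simp [hfdef]
    rw [this, hF.apply_eq_symEval, List.ofFn_cons, List.ofFn_cons, ← Multiset.cons_coe,
      ← Multiset.cons_coe, hg]
  have h0 : f 0 = x := rfl
  have h1 : f 1 = y := rfl
  simpa only [Set.mem_ofPred_eq, h0, h1, hb] using key

/-- Replacing a vector of the closed cone by a vector of the open cone preserves positivity. -/
theorem symEval_cons_pos_of_mem (hF : IsLorentzianForm C F) {s : Multiset V}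
    (hs : s.card + 1 = n) (h : ∀ x ∈ s, x ∈ closure C) {x y : V} (hy : y ∈ C)
    (hpos : 0 < symEval F (x ::ₘ s)) : 0 < symEval F (y ::ₘ s) := by
  obtain ⟨ε, hε, hmem⟩ : ∃ ε : ℝ, 0 < ε ∧ y - ε • x ∈ C := by
    have hc : Filter.Tendsto (fun ε : ℝ => y - ε • x) (nhdsWithin 0 (Set.Ioi 0)) (nhds y) := by
      have : Continuous fun ε : ℝ => y - ε • x := by fun_prop
      simpa using (this.tendsto 0).mono_left nhdsWithin_le_nhds
    obtain ⟨ε, h₁, h₂⟩ :=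
      ((hc.eventually (hF.isOpen.mem_nhds hy)).and self_mem_nhdsWithin).exists
    exact ⟨ε, h₂, h₁⟩
  have hnn : 0 ≤ symEval F ((y - ε • x) ::ₘ s) :=
    hF.symEval_nonneg (by simpa using hs) (by
      simpa [Multiset.forall_mem_cons] using ⟨subset_closure hmem, h⟩)
  obtain ⟨φ, hφ⟩ := hF.exists_linearMap hs
  rw [hφ] at hpos hnn ⊢
  rw [map_sub, map_smul, smul_eq_mul] at hnn
  have := mul_pos hε hpos
  linarith

/-- If `Q` is the bilinear form of `s`, then `Q(i,i) > 0` and `Q(j,w) > 0` imply `Q(i,j) > 0`. -/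
theorem symEval_cons_cons_pos (hF : IsLorentzianForm C F) {s : Multiset V} (hs : s.card + 2 = n)
    (h : ∀ x ∈ s, x ∈ closure C) {i j w : V} (hi : i ∈ closure C) (hj : j ∈ closure C)
    (hw : w ∈ C) (hii : 0 < symEval F (i ::ₘ i ::ₘ s))
    (hjw : 0 < symEval F (j ::ₘ w ::ₘ s)) : 0 < symEval F (i ::ₘ j ::ₘ s) := by
  have hnn : ∀ a b, a ∈ closure C → b ∈ closure C → 0 ≤ symEval F (a ::ₘ b ::ₘ s) :=
    fun a b ha hb => hF.symEval_nonneg (by simpa using hs) (by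
      simpa [Multiset.forall_mem_cons] using ⟨ha, hb, h⟩)
  have hadd : ∀ a b c, symEval F ((a + b) ::ₘ c ::ₘ s) =
      symEval F (a ::ₘ c ::ₘ s) + symEval F (b ::ₘ c ::ₘ s) := by
    intro a b c
    obtain ⟨φ, hφ⟩ := hF.exists_linearMap (s := c ::ₘ s) (by simp; omega)
    simp only [hφ, map_add]
  have hnsmul : ∀ (k : ℕ) (a c : V), symEval F ((k • a) ::ₘ c ::ₘ s) =
      k * symEval F (a ::ₘ c ::ₘ s) := by
    intro k a c
    obtain ⟨φ, hφ⟩ := hF.exists_linearMap (s := c ::ₘ s) (by simp; omega)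
    simp only [hφ, map_nsmul, nsmul_eq_mul]
  refine (hnn i j hi hj).lt_of_ne fun h0 => ?_
  obtain ⟨k, hk⟩ := exists_nat_gt (symEval F (i ::ₘ w ::ₘ s) ^ 2 /
    (symEval F (i ::ₘ i ::ₘ s) * symEval F (j ::ₘ w ::ₘ s)))
  rw [div_lt_iff₀ (mul_pos hii hjw)] at hk
  have hkj : k • j ∈ closure C := by
    rw [← Multiset.sum_replicate]
    exact hF.sum_mem_closure hw fun z hz => Multiset.eq_of_mem_replicate hz ▸ hj
  have key := hF.symEval_mul_le_sq hs h hi (hF.add_mem_closure hkj (subset_closure hw))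
  have e1 : symEval F (i ::ₘ (k • j + w) ::ₘ s) = symEval F (i ::ₘ w ::ₘ s) := by
    rw [Multiset.cons_swap, hadd, hnsmul, Multiset.cons_swap j i, ← h0, Multiset.cons_swap w i]
    ring
  have e2 : symEval F ((k • j + w) ::ₘ (k • j + w) ::ₘ s) =
      k * (k * symEval F (j ::ₘ j ::ₘ s)) + 2 * (k * symEval F (j ::ₘ w ::ₘ s)) +
        symEval F (w ::ₘ w ::ₘ s) := by
    rw [hadd, hnsmul, Multiset.cons_swap j, Multiset.cons_swap w, hadd, hadd, hnsmul, hnsmul,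
      Multiset.cons_swap w j]
    ring
  rw [e1, e2] at key
  have hjj := hnn j j hj hj
  have hww := hnn w w (subset_closure hw) (subset_closure hw)
  have hk0 : (0 : ℝ) ≤ k := k.cast_nonneg
  have hX : symEval F (i ::ₘ i ::ₘ s) * (k * symEval F (j ::ₘ w ::ₘ s)) ≤
      symEval F (i ::ₘ w ::ₘ s) ^ 2 := by
    refine le_trans (mul_le_mul_of_nonneg_left ?_ hii.le) key
    have := mul_nonneg hk0 (mul_nonneg hk0 hjj)
    have := mul_nonneg hk0 hjw.le
    nlinarith
  linarith

end IsLorentzianForm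

/-- Positivity of the form on `s`, completed by copies of `w`. -/
def PosPad {V : Type*} [AddCommGroup V] [Module ℝ V] {n : ℕ}
    (F : MultilinearMap ℝ (fun _ : Fin n => V) ℝ) (w : V) (s : Multiset V) : Prop :=
  0 < symEval F (s + Multiset.replicate (n - s.card) w)

theorem posPad_iff {V : Type*} [AddCommGroup V] [Module ℝ V] {n : ℕ}
    {F : MultilinearMap ℝ (fun _ : Fin n => V) ℝ} {w : V} {s : Multiset V} {r : ℕ}
    (hs : s.card + r = n) :
    PosPad F w s ↔ 0 < symEval F (s + Multiset.replicate r w) := by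
  rw [PosPad, show n - s.card = r by omega]

namespace IsLorentzianForm

variable {V : Type*} [NormedAddCommGroup V] [NormedSpace ℝ V] {n : ℕ}
  {C : Set V} {F : MultilinearMap ℝ (fun _ : Fin n => V) ℝ} {w : V}

theorem posPad_zero (hF : IsLorentzianForm C F) (hw : w ∈ C) : PosPad F w 0 := by
  have h := hF.pos (fun _ => w) fun _ => hw
  rw [hF.apply_eq_symEval, List.ofFn_const, Multiset.coe_replicate] at h
  simpa [PosPad] using h

theorem exists_posPad_of_posPad_sum (hF : IsLorentzianForm C F) {s t : Multiset V}
    (hs : s.card + 1 ≤ n) (h : PosPad F w (t.sum ::ₘ s)) : ∃ v ∈ t, PosPad F w (v ::ₘ s) := by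
  obtain ⟨r, hr⟩ := Nat.exists_eq_add_of_le hs
  have hp : ∀ v, PosPad F w (v ::ₘ s) ↔
      0 < symEval F (v ::ₘ (s + Multiset.replicate r w)) := fun v => by
    rw [posPad_iff (r := r) (by simp; omega), Multiset.cons_add]
  obtain ⟨φ, hφ⟩ := hF.exists_linearMap (s := s + Multiset.replicate r w) (by simp; omega)
  simp only [hp, hφ] at h ⊢
  by_contra! hle
  rw [map_multiset_sum] at h
  refine h.not_ge (Multiset.sum_induction (· ≤ 0) _ (fun _ _ => add_nonpos) le_rfl ?_)
  simpa using hle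

theorem posPad_replicate_numDim (hF : IsLorentzianForm C F) (hw : w ∈ C) (v : V) :
    numDim F w v ≤ n ∧ PosPad F w (Multiset.replicate (numDim F w v) v) := by
  have hmem : numDim F w v ∈ {k : ℕ | k ≤ n ∧ 0 < F (fun i => if (i : ℕ) < k then v else w)} :=
    Nat.sSup_mem ⟨0, Nat.zero_le n, by simpa using hF.pos (fun _ => w) fun _ => hw⟩
      ⟨n, fun k hk => hk.1⟩
  obtain ⟨hk, hpos⟩ := hmem
  refine ⟨hk, ?_⟩
  rw [hF.apply_eq_symEval] at hpos
  rw [posPad_iff (r := n - numDim F w v) (by simp; omega)]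
  convert hpos using 2
  rw [← Multiset.coe_replicate, ← Multiset.coe_replicate, Multiset.coe_add]
  congr 1
  refine List.ext_getElem (by simp; omega) fun i h₁ h₂ => ?_
  simp [List.getElem_append]

variable [FiniteDimensional ℝ V]

theorem posPad_of_cons (hF : IsLorentzianForm C F) (hw : w ∈ C) {s : Multiset V} {a : V}
    (hs : s.card + 1 ≤ n) (h : ∀ x ∈ s, x ∈ closure C) (hp : PosPad F w (a ::ₘ s)) :
    PosPad F w s := by
  obtain ⟨r, hr⟩ := Nat.exists_eq_add_of_le hs
  rw [posPad_iff (r := r) (by simp; omega), Multiset.cons_add] at hp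
  rw [posPad_iff (r := r + 1) (by omega), Multiset.replicate_succ, Multiset.add_cons]
  exact hF.symEval_cons_pos_of_mem (by simp; omega)
    (Multiset.forall_mem_add_replicate h (subset_closure hw)) hw hp

theorem posPad_mono (hF : IsLorentzianForm C F) (hw : w ∈ C) {s t : Multiset V} (hst : s ≤ t)
    (ht : t.card ≤ n) (h : ∀ x ∈ t, x ∈ closure C) (hp : PosPad F w t) : PosPad F w s := by
  obtain ⟨u, rfl⟩ := Multiset.le_iff_exists_add.1 hst
  induction u using Multiset.induction with
  | empty => simpa using hp
  | cons a u ih =>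
    rw [Multiset.add_cons] at ht h hp
    rw [Multiset.card_cons] at ht
    have h' : ∀ x ∈ s + u, x ∈ closure C := fun x hx => h x (Multiset.mem_cons_of_mem hx)
    exact ih (Multiset.le_add_right _ _) (by omega) h' (hF.posPad_of_cons hw ht h' hp)

theorem posPad_cons_cons (hF : IsLorentzianForm C F) (hw : w ∈ C) {s : Multiset V} {i j : V}
    (hs : s.card + 2 ≤ n) (h : ∀ x ∈ s, x ∈ closure C) (hi : i ∈ closure C) (hj : j ∈ closure C)
    (hii : PosPad F w (i ::ₘ i ::ₘ s)) (hjs : PosPad F w (j ::ₘ s)) :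
    PosPad F w (i ::ₘ j ::ₘ s) := by
  obtain ⟨r, hr⟩ := Nat.exists_eq_add_of_le hs
  rw [posPad_iff (r := r) (by simp; omega), Multiset.cons_add, Multiset.cons_add] at hii ⊢
  rw [posPad_iff (r := r + 1) (by simp; omega), Multiset.replicate_succ, Multiset.cons_add,
    Multiset.add_cons] at hjs
  exact hF.symEval_cons_cons_pos (by simp; omega)
    (Multiset.forall_mem_add_replicate h (subset_closure hw)) hi hj hw hii hjs

/-- A positive multiset may be augmented by a vector of larger numerical dimension. -/
theorem posPad_cons_of_replicate (hF : IsLorentzianForm C F) (hw : w ∈ C) {s : Multiset V} {x : V}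
    (hs : s.card + 1 ≤ n) (h : ∀ z ∈ s, z ∈ closure C) (hx : x ∈ closure C) (hp : PosPad F w s)
    (hxp : PosPad F w (Multiset.replicate (s.card + 1) x)) : PosPad F w (x ::ₘ s) := by
  suffices H : ∀ t : Multiset V, t ≤ s → ∀ r, t.card + r ≤ s.card + 1 →
      PosPad F w (t + Multiset.replicate r x) by
    have := H s le_rfl 1 le_rfl
    rwa [Multiset.replicate_one, Multiset.add_comm, Multiset.singleton_add] at this
  intro t
  induction t using Multiset.induction with
  | empty =>
    intro _ r hr
    rw [Multiset.zero_add]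
    refine hF.posPad_mono hw ((Multiset.replicate_le_replicate x).2 (by simpa using hr))
      (by simpa using hs) (fun z hz => Multiset.eq_of_mem_replicate hz ▸ hx) hxp
  | cons a t ih =>
    intro hts r
    have hts' : t ≤ s := (Multiset.le_cons_self t a).trans hts
    have ht : ∀ z ∈ t, z ∈ closure C := fun z hz => h z (Multiset.mem_of_le hts' hz)
    have ha : a ∈ closure C := h a (Multiset.mem_of_le hts (Multiset.mem_cons_self a t))
    induction r with
    | zero =>
      intro _
      simpa using hF.posPad_mono hw hts (by omega) h hp
    | succ r ihr =>
      intro hr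
      rw [Multiset.card_cons] at hr ihr
      have h₁ := ih hts' (r + 2) (by omega)
      have h₂ := ihr (by omega)
      rw [Multiset.replicate_succ, Multiset.add_cons, Multiset.replicate_succ,
        Multiset.add_cons] at h₁
      rw [Multiset.cons_add] at h₂
      have := hF.posPad_cons_cons hw (by simp; omega) (Multiset.forall_mem_add_replicate ht hx)
        hx ha h₁ h₂
      rwa [Multiset.replicate_succ, Multiset.add_cons, Multiset.cons_add]

/-- A Hall–Rado criterion: the form is positive on `s` as soon as every sub-multiset `t` of `s`
has a sum of numerical dimension at least the cardinality of `t`. -/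
theorem posPad_of_forall_le (hF : IsLorentzianForm C F) (hw : w ∈ C) (s : Multiset V)
    (hs : s.card ≤ n) (h : ∀ z ∈ s, z ∈ closure C)
    (hp : ∀ t ≤ s, t ≠ 0 → PosPad F w (Multiset.replicate t.card t.sum)) : PosPad F w s := by
  induction s using Multiset.strongInductionOn with
  | ih s ih =>
  have hlt : ∀ t < s, PosPad F w t := fun t ht =>
    ih t ht ((Multiset.card_le_card ht.le).trans hs) (fun z hz => h z (Multiset.mem_of_le ht.le hz))
      fun u hu => hp u (hu.trans ht.le)
  rcases s.empty_or_exists_mem with rfl | ⟨a, ha⟩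
  · exact hF.posPad_zero hw
  obtain ⟨b, rfl⟩ := Multiset.exists_cons_of_mem ha
  have hb : ∀ z ∈ b, z ∈ closure C := fun z hz => h z (Multiset.mem_cons_of_mem hz)
  rw [Multiset.card_cons] at hs
  have hsum := hp _ le_rfl (Multiset.cons_ne_zero)
  rw [Multiset.card_cons] at hsum
  obtain ⟨v, hv, hvb⟩ := hF.exists_posPad_of_posPad_sum hs
    (hF.posPad_cons_of_replicate hw hs hb (hF.sum_mem_closure hw h)
      (hlt b (Multiset.lt_cons_self b a)) hsum)
  rcases Multiset.mem_cons.1 hv with rfl | hv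
  · exact hvb
  obtain ⟨k, rfl⟩ := Multiset.exists_cons_of_mem hv
  have hak := hlt (a ::ₘ k) (Multiset.cons_lt_cons a (Multiset.lt_cons_self k v))
  rw [Multiset.cons_swap]
  rw [Multiset.card_cons] at hs
  exact hF.posPad_cons_cons hw (by omega) (fun z hz => hb z (Multiset.mem_cons_of_mem hz))
    (hb v (Multiset.mem_cons_self v k)) (h a ha) hvb hak

theorem posPad_replicate_of_le_numDim (hF : IsLorentzianForm C F) (hw : w ∈ C) {v : V}
    (hv : v ∈ closure C) {k : ℕ} (hk : k ≤ numDim F w v) :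
    PosPad F w (Multiset.replicate k v) := by
  obtain ⟨hle, hp⟩ := hF.posPad_replicate_numDim hw v
  exact hF.posPad_mono hw ((Multiset.replicate_le_replicate v).2 hk) (by simpa using hle)
    (fun z hz => Multiset.eq_of_mem_replicate hz ▸ hv) hp

theorem posPad_replicate_add (hF : IsLorentzianForm C F) (hw : w ∈ C) {x y : V}
    (hx : x ∈ closure C) (hy : y ∈ closure C) {k : ℕ} (hk : k ≤ n)
    (hp : PosPad F w (Multiset.replicate k x)) : PosPad F w (Multiset.replicate k (x + y)) := by
  rw [posPad_iff (r := n - k) (by simp; omega)] at hp ⊢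
  refine symEval_replicate_pos_of_forall hx (hF.add_mem_closure hx hy) (fun s hs h hpos => ?_) k _
    (by simp; omega) (fun z hz => Multiset.eq_of_mem_replicate hz ▸ subset_closure hw) hp
  obtain ⟨φ, hφ⟩ := hF.exists_linearMap hs
  have hnn : 0 ≤ symEval F (y ::ₘ s) :=
    hF.symEval_nonneg (by simpa using hs) (by
      simpa [Multiset.forall_mem_cons] using ⟨hy, h⟩)
  rw [hφ] at hpos hnn ⊢
  rw [map_add]
  linarith

theorem symEval_pos_of_posPad (hF : IsLorentzianForm C F) (hw : w ∈ C) {ω : V} (hω : ω ∈ C)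
    {s : Multiset V} {r : ℕ} (hs : s.card + r = n) (h : ∀ z ∈ s, z ∈ closure C)
    (hp : PosPad F w s) : 0 < symEval F (s + Multiset.replicate r ω) := by
  rw [posPad_iff hs, Multiset.add_comm] at hp
  rw [Multiset.add_comm]
  exact symEval_replicate_pos_of_forall (subset_closure hw) (subset_closure hω)
    (fun t ht h' => hF.symEval_cons_pos_of_mem ht h' hω) r s hs h hp

end IsLorentzianForm

/-- Let `F` be a `C`-Lorentzian symmetric `n`-multilinear form (`n ≥ 3`).
Let `L₁, ..., L_{n-2}` in the closure of `C` be a subcritical collection (`nd(L_I) ≥ |I|`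
for every nonempty `I ⊆ [n-2]`), and let `M` be the union of all subcritical subsets
(those `S` with `nd(L_S) = |S|`). Then for every nonempty `I ⊆ [n-2] \ M` and every `ω ∈ C`,
`F` evaluated at `|I|+1` copies of `L_I`, the classes `L_m` for `m ∈ M`, and
`n - |I| - 1 - |M|` copies of `ω` is strictly positive. -/
theorem subcritical_complement_critical
    {V : Type*} [NormedAddCommGroup V] [NormedSpace ℝ V] [FiniteDimensional ℝ V]
    {n : ℕ} (hn : 3 ≤ n)
    (C : Set V) (hCne : C.Nonempty) (hCopen : IsOpen C) (hCconv : Convex ℝ C)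
    (hCcone : ∀ x ∈ C, ∀ t : ℝ, 0 < t → t • x ∈ C)
    (F : MultilinearMap ℝ (fun _ : Fin n => V) ℝ)
    (hFsymm : ∀ (σ : Equiv.Perm (Fin n)) (v : Fin n → V), F (v ∘ σ) = F v)
    (hFpos : ∀ v : Fin n → V, (∀ i, v i ∈ C) → 0 < F v)
    (hFlor : ∀ v : Fin n → V, (∀ i : Fin n, 2 ≤ (i : ℕ) → v i ∈ C) →
      (∃ ξ : V, 0 < biEval F v ξ ξ) ∧
      ∀ W : Submodule ℝ V, (∀ ξ ∈ W, ξ ≠ 0 → 0 < biEval F v ξ ξ) →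
        Module.finrank ℝ W ≤ 1)
    (w : V) (hw : w ∈ C)
    (L : Fin (n - 2) → V) (hL : ∀ i, L i ∈ closure C)
    (hsub : ∀ I : Finset (Fin (n - 2)), I.Nonempty → I.card ≤ numDim F w (∑ i ∈ I, L i))
    (M : Finset (Fin (n - 2)))
    (hM : ∀ i : Fin (n - 2), i ∈ M ↔
      ∃ S : Finset (Fin (n - 2)), i ∈ S ∧ numDim F w (∑ j ∈ S, L j) = S.card)
    (I : Finset (Fin (n - 2))) (hIne : I.Nonempty) (hIM : ∀ i ∈ I, i ∉ M)
    (ω : V) (hω : ω ∈ C) :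
    0 < F (fun j =>
      if h1 : (j : ℕ) < I.card + 1 then ∑ i ∈ I, L i
      else if h2 : (j : ℕ) < I.card + 1 + M.card then
        L ↑(M.orderIsoOfFin rfl ⟨(j : ℕ) - (I.card + 1), by omega⟩)
      else ω) := by
  have hF : IsLorentzianForm C F :=
    ⟨hCopen, hCconv, hCcone, hFsymm, hFpos, fun v hv => (hFlor v hv).2⟩
  have hLmem : ∀ J : Finset (Fin (n - 2)), ∑ i ∈ J, L i ∈ closure C := fun J =>
    hF.sum_mem_closure hw (by simpa using fun i _ => hL i)
  have hdisj : Disjoint I M := Finset.disjoint_left.2 hIM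
  have hcard : I.card + M.card ≤ n - 2 := by
    rw [← Finset.card_union_of_disjoint hdisj]
    simpa using Finset.card_le_univ (I ∪ M)
  set s : Multiset V := Multiset.replicate (I.card + 1) (∑ i ∈ I, L i) + M.val.map L with hs
  have hscard : s.card = I.card + 1 + M.card := by simp only [hs, Multiset.card_add,
    Multiset.card_replicate, Multiset.card_map, Finset.card_val]
  have hsmem : ∀ z ∈ s, z ∈ closure C := by
    intro z hz
    rcases Multiset.mem_add.1 hz with hz | hz
    · exact Multiset.eq_of_mem_replicate hz ▸ hLmem I
    · obtain ⟨i, -, rfl⟩ := Multiset.mem_map.1 hz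
      exact hL i
  have hpos : PosPad F w s := by
    refine hF.posPad_of_forall_le hw s (by omega) hsmem fun t ht ht0 => ?_
    classical
    obtain ⟨k, J, hk, hJM, rfl⟩ : ∃ (k : ℕ) (J : Finset (Fin (n - 2))), k ≤ I.card + 1 ∧ J ⊆ M ∧
        t = Multiset.replicate k (∑ i ∈ I, L i) + J.val.map L := by
      obtain ⟨u, hu, hu'⟩ := Multiset.exists_le_map_eq_of_le_map
        (tsub_le_iff_left.2 ht : t - Multiset.replicate (I.card + 1) (∑ i ∈ I, L i) ≤ _)
      obtain ⟨k, hk, hk'⟩ := Multiset.le_replicate_iff.1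
        (Multiset.inter_le_right (s := t) (t := Multiset.replicate (I.card + 1) (∑ i ∈ I, L i)))
      refine ⟨k, ⟨u, Multiset.nodup_of_le hu M.nodup⟩, hk, Finset.val_le_iff.1 hu, ?_⟩
      rw [← hk', hu', Multiset.add_comm, Multiset.sub_add_inter]
    have hsum : (Multiset.replicate k (∑ i ∈ I, L i) + J.val.map L).sum =
        k • (∑ i ∈ I, L i) + ∑ i ∈ J, L i := by simp
    have hcd : (Multiset.replicate k (∑ i ∈ I, L i) + J.val.map L).card = k + J.card := by simp
    have hJcard := Finset.card_le_card hJM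
    rw [hsum, hcd]
    rcases Nat.eq_zero_or_pos k with rfl | hk0
    · have hJ : J.Nonempty := by
        rw [Finset.nonempty_iff_ne_empty]
        rintro rfl
        simp at ht0
      simpa using hF.posPad_replicate_of_le_numDim hw (hLmem J) (hsub J hJ)
    · obtain ⟨l, rfl⟩ := Nat.exists_eq_add_of_le' hk0
      have hIJ : I.card + J.card + 1 ≤ numDim F w (∑ i ∈ I ∪ J, L i) := by
        rw [← Finset.card_union_of_disjoint (hdisj.mono_right hJM)]
        refine (hsub (I ∪ J) (hIne.mono Finset.subset_union_left)).lt_of_ne fun heq => ?_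
        obtain ⟨i, hi⟩ := hIne
        exact hIM i hi ((hM i).2 ⟨I ∪ J, Finset.mem_union_left J hi, heq.symm⟩)
      have hp := hF.posPad_replicate_add hw (hLmem (I ∪ J))
        (hF.sum_mem_closure hw (s := Multiset.replicate l (∑ i ∈ I, L i))
          fun z hz => Multiset.eq_of_mem_replicate hz ▸ hLmem I) (by omega)
        (hF.posPad_replicate_of_le_numDim hw (hLmem (I ∪ J))
          (by omega : l + 1 + J.card ≤ _))
      rw [Finset.sum_union (hdisj.mono_right hJM), Multiset.sum_replicate] at hp
      convert hp using 2
      rw [succ_nsmul]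
      abel
  have hfinal := hF.symEval_pos_of_posPad hw hω
    (r := n - (I.card + 1 + M.card)) (by omega) hsmem hpos
  rw [hF.apply_eq_symEval]
  convert hfinal using 2
  rw [hs, ← Finset.sort_eq M (· ≤ ·), Multiset.map_coe, ← Multiset.coe_replicate,
    ← Multiset.coe_replicate, Multiset.coe_add, Multiset.coe_add]
  congr 1
  refine List.ext_getElem (by simp; omega) fun i h₁ h₂ => ?_
  by_cases hi : i < I.card + 1
  · simp [hi, show i ≤ I.card by omega]
  · have hle : ¬ i ≤ I.card := by omega
    by_cases hi' : i < I.card + 1 + M.card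
    · simp [List.getElem_append, hle, hi', show i - (I.card + 1) < M.card by omega,
        Finset.orderEmbOfFin_apply]
    · simp [List.getElem_append, hle, hi', show ¬ i - (I.card + 1) < M.card by omega]
end
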